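/- Let O' be an n-qubit homogeneous k-local observable and O = pol(O') its polarization on nk qubits. Then Tr(O'²) = k! · Tr(O²), and for |ψ⟩ a tensor product of nk independent Haar-random single-qubit pure states, E_{|ψ⟩}|⟨ψ|O|ψ⟩| ≥ (1/√6)^k · √(Tr(O²)/2ⁿ). -/

import Mathlib

open scoped BigOperators
open Matrix MeasureTheory

noncomputable instance matrixMeasurableSpace {m n : Type*} :
    MeasurableSpace (Matrix m n ℂ) := MeasurableSpace.pi

/-- The four single-qubit Pauli matrices `I, X, Y, Z`. -/
noncomputable def pauli : Fin 4 → Matrix (Fin 2) (Fin 2) ℂ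
  | 0 => 1
  | 1 => !![0, 1; 1, 0]
  | 2 => !![0, -Complex.I; Complex.I, 0]
  | 3 => !![1, 0; 0, -1]

/-- A Pauli string over an arbitrary finite index set of qubits. -/
noncomputable def pauliStringOn {ι : Type*} [Fintype ι] (P : ι → Fin 4) :
    Matrix (ι → Fin 2) (ι → Fin 2) ℂ :=
  fun x y => ∏ i, pauli (P i) (x i) (y i)

/-- The support (set of qubits acted on nontrivially) of a Pauli string. -/
def psupp {n : ℕ} (P : Fin n → Fin 4) : Finset (Fin n) :=
  Finset.univ.filter (fun i => P i ≠ 0)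

/-- For a weight-`k` Pauli string `P` acting on qubits `i₁ < ⋯ < i_k` and a
permutation `π ∈ S_k`, the `nk`-qubit Pauli string (qubits indexed by pairs
`(s, i)`, `s ∈ [k]`, `i ∈ [n]`) acting via `P_{i_s}` on qubit `(π(s), i_s)`. -/
def polString {n k : ℕ} (P : Fin n → Fin 4) (hP : (psupp P).card = k)
    (π : Equiv.Perm (Fin k)) : Fin k × Fin n → Fin 4 :=
  fun ci =>
    if h : ci.2 ∈ psupp P then
      (if ci.1 = π (((psupp P).orderIsoOfFin hP).symm ⟨ci.2, h⟩) then P ci.2 else 0)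
    else 0

/-- The single-qubit pure state `U|0⟩`. -/
noncomputable def haarVec (U : Matrix (Fin 2) (Fin 2) ℂ) : Fin 2 → ℂ :=
  U.mulVec (fun j => if j = 0 then 1 else 0)

/-- The product state `⊗ᵢ |ψᵢ⟩⟨ψᵢ|` with `|ψᵢ⟩ = Uᵢ|0⟩`, over any finite index set. -/
noncomputable def productStateOn {ι : Type*} [Fintype ι]
    (U : ι → Matrix (Fin 2) (Fin 2) ℂ) : Matrix (ι → Fin 2) (ι → Fin 2) ℂ :=
  fun x y => ∏ i, haarVec (U i) (x i) * (starRingEnd ℂ) (haarVec (U i) (y i))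

/-! ### The Rademacher inequality with the sharp constant -/

/-- The sign `±1` attached to a boolean. -/
def boolSign (b : Bool) : ℝ := if b then 1 else -1

lemma boolSign_not (b : Bool) : boolSign (!b) = -boolSign b := by
  cases b <;> simp [boolSign]

lemma boolSign_sq (b : Bool) : boolSign b * boolSign b = 1 := by
  cases b <;> simp [boolSign]

/-- Flip one coordinate of a point of the discrete cube. -/
def cubeFlip {J : Type*} [DecidableEq J] (i : J) (x : J → Bool) : J → Bool :=
  Function.update x i (!x i)

lemma cubeFlip_cubeFlip {J : Type*} [DecidableEq J] (i : J) (x : J → Bool) :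
    cubeFlip i (cubeFlip i x) = x := by
  simp [cubeFlip]

lemma sum_comp_cubeFlip {J : Type*} [Fintype J] [DecidableEq J] (i : J) (f : (J → Bool) → ℝ) :
    ∑ x, f (cubeFlip i x) = ∑ x, f x :=
  Equiv.sum_comp (Function.Involutive.toPerm _ (cubeFlip_cubeFlip i)) f

/-- The (unnormalized) Dirichlet form of the discrete cube. -/
noncomputable def cubeEnergy {n : ℕ} (f : (Fin n → Bool) → ℝ) : ℝ :=
  ∑ i, ∑ x, ((f x - f (cubeFlip i x)) / 2) ^ 2

lemma cubeEnergy_nonneg {n : ℕ} (f : (Fin n → Bool) → ℝ) : 0 ≤ cubeEnergy f :=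
  Finset.sum_nonneg fun _ _ => Finset.sum_nonneg fun _ _ => sq_nonneg _

lemma sum_cube_succ {n : ℕ} (f : (Fin (n + 1) → Bool) → ℝ) :
    ∑ x, f x = ∑ y : Fin n → Bool, (f (Fin.cons true y) + f (Fin.cons false y)) := by
  rw [← (Fin.consEquiv fun _ : Fin (n + 1) => Bool).sum_comp f, Fintype.sum_prod_type,
    Fintype.sum_bool, Finset.sum_add_distrib]
  rfl

lemma cubeFlip_zero_cons {n : ℕ} (b : Bool) (y : Fin n → Bool) :
    cubeFlip 0 (Fin.cons b y : Fin (n + 1) → Bool) = Fin.cons (!b) y := by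
  simp [cubeFlip, Fin.update_cons_zero]

lemma cubeFlip_succ_cons {n : ℕ} (b : Bool) (i : Fin n) (y : Fin n → Bool) :
    cubeFlip i.succ (Fin.cons b y : Fin (n + 1) → Bool) = Fin.cons b (cubeFlip i y) := by
  simp [cubeFlip, Fin.cons_update]

/-- The average of a function over its first coordinate. -/
noncomputable def cubeAvg {n : ℕ} (f : (Fin (n + 1) → Bool) → ℝ) (y : Fin n → Bool) : ℝ :=
  (f (Fin.cons true y) + f (Fin.cons false y)) / 2

/-- The half-difference of a function in its first coordinate. -/
noncomputable def cubeDiff {n : ℕ} (f : (Fin (n + 1) → Bool) → ℝ) (y : Fin n → Bool) : ℝ :=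
  (f (Fin.cons true y) - f (Fin.cons false y)) / 2

lemma cubeEnergy_succ {n : ℕ} (f : (Fin (n + 1) → Bool) → ℝ) :
    cubeEnergy f = 2 * ∑ y, cubeDiff f y ^ 2 + 2 * cubeEnergy (cubeAvg f)
      + 2 * cubeEnergy (cubeDiff f) := by
  simp only [cubeEnergy, Fin.sum_univ_succ, sum_cube_succ, cubeFlip_zero_cons, cubeFlip_succ_cons,
    Finset.mul_sum, add_assoc, ← Finset.sum_add_distrib]
  congr 1
  · refine Finset.sum_congr rfl fun y _ => ?_
    simp only [cubeDiff, Bool.not_true, Bool.not_false]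
    ring
  · refine Finset.sum_congr rfl fun i _ => Finset.sum_congr rfl fun y _ => ?_
    simp only [cubeDiff, cubeAvg]
    ring

lemma sum_sq_cube_succ {n : ℕ} (f : (Fin (n + 1) → Bool) → ℝ) :
    ∑ x, f x ^ 2 = 2 * ∑ y, cubeAvg f y ^ 2 + 2 * ∑ y, cubeDiff f y ^ 2 := by
  simp only [sum_cube_succ, Finset.mul_sum, ← Finset.sum_add_distrib]
  refine Finset.sum_congr rfl fun y _ => ?_
  simp only [cubeDiff, cubeAvg]
  ring

lemma sum_cube_succ_eq_avg {n : ℕ} (f : (Fin (n + 1) → Bool) → ℝ) :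
    ∑ x, f x = 2 * ∑ y, cubeAvg f y := by
  simp only [sum_cube_succ, Finset.mul_sum]
  refine Finset.sum_congr rfl fun y _ => ?_
  simp only [cubeAvg]
  ring

lemma poincare_cube : ∀ {n : ℕ} (f : (Fin n → Bool) → ℝ),
    ∑ x, f x ^ 2 - (∑ x, f x) ^ 2 / 2 ^ n ≤ cubeEnergy f
  | 0, f => by simp [cubeEnergy]
  | n + 1, f => by
    rw [cubeEnergy_succ, sum_sq_cube_succ, sum_cube_succ_eq_avg]
    have h1 := poincare_cube (cubeAvg f)
    have h2 := cubeEnergy_nonneg (cubeDiff f)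
    have h3 : (2 * ∑ y, cubeAvg f y) ^ 2 / 2 ^ (n + 1) = 2 * ((∑ y, cubeAvg f y) ^ 2 / 2 ^ n) := by
      rw [pow_succ (2 : ℝ) n]; field_simp
    linarith

/-- The spectral gap of the cube improves to `2` orthogonally to the first level. -/
lemma second_gap_cube : ∀ {n : ℕ} (f : (Fin n → Bool) → ℝ),
    2 * (∑ x, f x ^ 2 - (∑ x, f x) ^ 2 / 2 ^ n)
      - (∑ i, (∑ x, boolSign (x i) * f x) ^ 2) / 2 ^ n ≤ cubeEnergy f
  | 0, f => by simp [cubeEnergy]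
  | n + 1, f => by
    rw [cubeEnergy_succ, sum_sq_cube_succ, sum_cube_succ_eq_avg, Fin.sum_univ_succ]
    have h1 := second_gap_cube (cubeAvg f)
    have h2 := poincare_cube (cubeDiff f)
    have h0 : ∑ x, boolSign (x 0) * f x = 2 * ∑ y, cubeDiff f y := by
      simp only [sum_cube_succ, Finset.mul_sum]
      refine Finset.sum_congr rfl fun y _ => ?_
      simp [cubeDiff, boolSign]
      ring
    have hs (i : Fin n) : ∑ x, boolSign (x i.succ) * f x
        = 2 * ∑ y, boolSign (y i) * cubeAvg f y := by
      simp only [sum_cube_succ, Finset.mul_sum]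
      refine Finset.sum_congr rfl fun y _ => ?_
      simp [cubeAvg]
      ring
    have h3 (t : ℝ) : (2 * t) ^ 2 / 2 ^ (n + 1) = 2 * (t ^ 2 / 2 ^ n) := by
      rw [pow_succ (2 : ℝ) n]; field_simp
    simp only [h0, hs, add_div, Finset.sum_div, h3, ← Finset.mul_sum] at h1 h2 ⊢
    linarith

/-- Khintchine's inequality for Rademacher sums with the sharp constant, in squared form. -/
lemma rademacher_khintchine_fin {n : ℕ} (a : Fin n → ℝ) :
    2 ^ n * (2 ^ n * ∑ i, a i ^ 2) ≤ 2 * (∑ x : Fin n → Bool, |∑ i, a i * boolSign (x i)|) ^ 2 := by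
  set S : (Fin n → Bool) → ℝ := fun x => ∑ i, a i * boolSign (x i) with hS
  have hflip (i : Fin n) (x : Fin n → Bool) :
      S (cubeFlip i x) = S x - 2 * (a i * boolSign (x i)) := by
    have : S (cubeFlip i x) - S x = ∑ j, if j = i then -2 * (a i * boolSign (x i)) else 0 := by
      rw [hS, ← Finset.sum_sub_distrib]
      refine Finset.sum_congr rfl fun j _ => ?_
      by_cases h : j = i
      · subst h; simp [cubeFlip, boolSign_not]; ring
      · simp [cubeFlip, h]
    rw [Finset.sum_ite_eq' Finset.univ i] at this
    simp at this
    linarith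
  have hsq : ∑ x, |S x| ^ 2 = 2 ^ n * ∑ i, a i ^ 2 := by
    have hij (i j : Fin n) : ∑ x : Fin n → Bool, boolSign (x i) * boolSign (x j)
        = if i = j then 2 ^ n else 0 := by
      by_cases h : i = j
      · subst h; simp [boolSign_sq]
      · have := sum_comp_cubeFlip i fun x : Fin n → Bool => boolSign (x i) * boolSign (x j)
        simp only [cubeFlip, Function.update_self, boolSign_not,
          Function.update_of_ne (Ne.symm h), neg_mul, Finset.sum_neg_distrib] at this
        rw [if_neg h]
        linarith
    calc ∑ x, |S x| ^ 2
        = ∑ x : Fin n → Bool, ∑ i, ∑ j, a i * a j * (boolSign (x i) * boolSign (x j)) := by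
          refine Finset.sum_congr rfl fun x _ => ?_
          rw [sq_abs, sq, hS, Finset.sum_mul_sum]
          refine Finset.sum_congr rfl fun i _ => Finset.sum_congr rfl fun j _ => by ring
      _ = ∑ i, ∑ j, a i * a j * ∑ x : Fin n → Bool, boolSign (x i) * boolSign (x j) := by
          rw [Finset.sum_comm]
          refine Finset.sum_congr rfl fun i _ => ?_
          rw [Finset.sum_comm]
          refine Finset.sum_congr rfl fun j _ => ?_
          rw [Finset.mul_sum]
      _ = _ := by
          simp only [hij, mul_ite, mul_zero, Finset.sum_ite_eq, Finset.mem_univ, if_true,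
            Finset.mul_sum]
          refine Finset.sum_congr rfl fun i _ => by ring
  have hlevel (i : Fin n) : ∑ x, boolSign (x i) * |S x| = 0 := by
    have hinv : Function.Involutive fun (x : Fin n → Bool) j => !x j := fun x => by simp
    have := Equiv.sum_comp hinv.toPerm fun x => boolSign (x i) * |S x|
    have hneg (x : Fin n → Bool) : S (fun j => !x j) = -S x := by
      simp [hS, boolSign_not]
    simp only [Function.Involutive.coe_toPerm, hneg, boolSign_not, abs_neg, neg_mul,
      Finset.sum_neg_distrib] at this
    linarith
  have henergy : cubeEnergy (fun x => |S x|) ≤ ∑ x, |S x| ^ 2 := by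
    have h1 (i : Fin n) : ∑ x, ((|S x| - |S (cubeFlip i x)|) / 2) ^ 2
        = ∑ x, |S x| * ((|S x| - |S (cubeFlip i x)|) / 2) := by
      have := sum_comp_cubeFlip i fun x => |S x| * ((|S x| - |S (cubeFlip i x)|) / 2)
      simp only [cubeFlip_cubeFlip] at this
      have h2 : ∑ x, ((|S x| - |S (cubeFlip i x)|) / 2) ^ 2
          = (∑ x, |S x| * ((|S x| - |S (cubeFlip i x)|) / 2)
            + ∑ x, |S (cubeFlip i x)| * ((|S (cubeFlip i x)| - |S x|) / 2)) / 2 := by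
        rw [← Finset.sum_add_distrib, Finset.sum_div]
        refine Finset.sum_congr rfl fun x _ => by ring
      rw [h2, this]; ring
    rw [cubeEnergy]
    simp only [h1]
    rw [Finset.sum_comm]
    refine Finset.sum_le_sum fun x _ => ?_
    rw [← Finset.mul_sum, sq]
    refine mul_le_mul_of_nonneg_left ?_ (abs_nonneg _)
    rw [← Finset.sum_div, Finset.sum_sub_distrib]
    have h3 : |((n : ℝ) - 2) * S x| ≤ ∑ i, |S (cubeFlip i x)| := by
      refine le_trans (le_of_eq ?_) (Finset.abs_sum_le_sum_abs _ _)
      simp only [hflip, Finset.sum_sub_distrib, ← Finset.mul_sum]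
      simp [hS, sub_mul]
    rw [abs_mul] at h3
    have h4 : ((n : ℝ) - 2) * |S x| ≤ |(n : ℝ) - 2| * |S x| :=
      mul_le_mul_of_nonneg_right (le_abs_self _) (abs_nonneg _)
    simp only [Finset.sum_const, Finset.card_univ, Fintype.card_fin, nsmul_eq_mul]
    linarith
  have hgap := second_gap_cube fun x => |S x|
  simp only [hlevel, ne_eq, OfNat.ofNat_ne_zero, not_false_eq_true, zero_pow,
    Finset.sum_const_zero, zero_div, sub_zero] at hgap
  have hfin := hgap.trans henergy
  rw [hsq] at hfin
  have hN : (0 : ℝ) < 2 ^ n := by positivity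
  have h5 : 2 ^ n * ∑ i, a i ^ 2 ≤ 2 * (∑ x, |S x|) ^ 2 / 2 ^ n := by
    rw [mul_div_assoc]; linarith
  rw [le_div_iff₀ hN] at h5
  linarith

lemma rademacher_khintchine {J : Type*} [Fintype J] [DecidableEq J] (a : J → ℝ) :
    (√2)⁻¹ * √(∑ j, a j ^ 2) ≤
      (2 ^ Fintype.card J)⁻¹ * ∑ x : J → Bool, |∑ j, a j * boolSign (x j)| := by
  let e := (Fintype.equivFin J).symm
  have h := rademacher_khintchine_fin (a ∘ e)
  have h1 : ∑ i, (a ∘ e) i ^ 2 = ∑ j, a j ^ 2 := e.sum_comp fun j => a j ^ 2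
  have h2 : ∑ x : Fin (Fintype.card J) → Bool, |∑ i, (a ∘ e) i * boolSign (x i)|
      = ∑ x : J → Bool, |∑ j, a j * boolSign (x j)| := by
    rw [← (Equiv.arrowCongr e (Equiv.refl Bool)).sum_comp]
    refine Finset.sum_congr rfl fun x _ => ?_
    rw [← e.sum_comp]
    simp
  rw [h1, h2] at h
  set T := ∑ x : J → Bool, |∑ j, a j * boolSign (x j)|
  have hT : 0 ≤ T := Finset.sum_nonneg fun _ _ => abs_nonneg _
  rw [← Real.sqrt_inv, ← Real.sqrt_mul (by positivity)]
  refine Real.sqrt_le_iff.2 ⟨by positivity, ?_⟩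
  have hN : (0 : ℝ) < 2 ^ Fintype.card J := by positivity
  rw [mul_pow, inv_pow, inv_mul_eq_div, inv_mul_eq_div, le_div_iff₀ (by positivity)]
  nlinarith

/-! ### Sums of independent uniform variables -/

/-- The uniform probability measure on `[-1, 1]`. -/
noncomputable def unifMeasure : Measure ℝ := (2⁻¹ : ENNReal) • volume.restrict (Set.Ioc (-1) 1)

/-- The uniform probability measure on the booleans. -/
noncomputable def coinMeasure : Measure Bool := (2⁻¹ : ENNReal) • Measure.count

instance : IsProbabilityMeasure unifMeasure := ⟨by
  simp only [unifMeasure, Measure.smul_apply, Measure.restrict_apply_univ, Real.volume_Ioc,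
    smul_eq_mul]
  norm_num
  exact ENNReal.inv_mul_cancel (by simp) (by simp)⟩

instance : IsProbabilityMeasure coinMeasure := ⟨by
  simp only [coinMeasure, Measure.smul_apply, Measure.count_univ, smul_eq_mul]
  simp
  exact ENNReal.inv_mul_cancel (by simp) (by simp)⟩

lemma integral_unifMeasure (f : ℝ → ℝ) :
    ∫ x, f x ∂unifMeasure = 2⁻¹ * ∫ x in (-1 : ℝ)..1, f x := by
  rw [unifMeasure, integral_smul_measure, intervalIntegral.integral_of_le (by norm_num)]
  simp

lemma integral_coinMeasure (f : Bool → ℝ) :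
    ∫ b, f b ∂coinMeasure = 2⁻¹ * (f true + f false) := by
  rw [coinMeasure, integral_smul_measure, integral_count]
  simp

lemma unifMeasure_self_similar :
    (coinMeasure.prod unifMeasure).map (fun p => (boolSign p.1 + p.2) / 2) = unifMeasure := by
  have hm : Measurable fun p : Bool × ℝ => (boolSign p.1 + p.2) / 2 :=
    (((measurable_of_finite boolSign).comp measurable_fst).add measurable_snd).div_const 2
  have := Measure.isProbabilityMeasure_map (μ := coinMeasure.prod unifMeasure) hm.aemeasurable
  refine ext_of_forall_integral_eq_of_IsFiniteMeasure fun f => ?_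
  rw [integral_map hm.aemeasurable f.continuous.aestronglyMeasurable, integral_prod]
  · simp only [integral_coinMeasure, integral_unifMeasure]
    have h (c : ℝ) : ∫ x in (-1 : ℝ)..1, f ((c + x) / 2)
        = 2 * ∫ x in ((c - 1) / 2)..((c + 1) / 2), f x := by
      have := intervalIntegral.integral_comp_add_div (a := -1) (b := 1) (fun x => f x)
        (two_ne_zero) (c / 2)
      simp only [← add_div, smul_eq_mul] at this
      rw [this]
      ring_nf
    rw [h, h]
    have h2 := intervalIntegral.integral_add_adjacent_intervals (a := -1) (b := 0) (c := 1)
      (f := fun x => f x) (μ := volume) (f.continuous.intervalIntegrable _ _)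
      (f.continuous.intervalIntegrable _ _)
    simp only [boolSign]
    norm_num
    linarith
  · exact Integrable.of_bound (f.continuous.measurable.comp hm).aestronglyMeasurable ‖f‖
      (ae_of_all _ fun _ => f.norm_coe_le_norm _)

lemma integral_pi_coinMeasure {J : Type*} [Fintype J] [DecidableEq J] (f : (J → Bool) → ℝ) :
    ∫ x, f x ∂(Measure.pi fun _ : J => coinMeasure) = (2 ^ Fintype.card J)⁻¹ * ∑ x, f x := by
  rw [integral_fintype (Integrable.of_finite), Finset.mul_sum]
  refine Finset.sum_congr rfl fun x _ => ?_
  rw [smul_eq_mul]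
  congr 1
  rw [measureReal_def, Measure.pi_singleton]
  simp [coinMeasure]

lemma integral_pi_unifMeasure_self_similar {ι : Type*} [Fintype ι] [DecidableEq ι]
    (G : (ι → ℝ) → ℝ) (hG : Integrable G (Measure.pi fun _ => unifMeasure)) :
    ∫ u, G u ∂(Measure.pi fun _ => unifMeasure) = (2 ^ Fintype.card ι)⁻¹ * ∑ e : ι → Bool,
      ∫ u, G (fun i => (boolSign (e i) + u i) / 2) ∂(Measure.pi fun _ => unifMeasure) := by
  have hm : Measurable fun p : Bool × ℝ => (boolSign p.1 + p.2) / 2 :=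
    (((measurable_of_finite boolSign).comp measurable_fst).add measurable_snd).div_const 2
  have hpres : MeasurePreserving (fun (z : ι → Bool × ℝ) i => (boolSign (z i).1 + (z i).2) / 2)
      (Measure.pi fun _ => coinMeasure.prod unifMeasure) (Measure.pi fun _ => unifMeasure) :=
    measurePreserving_pi _ _ fun _ => ⟨hm, unifMeasure_self_similar⟩
  have harr := (measurePreserving_arrowProdEquivProdArrow Bool ℝ ι
    (fun _ => coinMeasure) (fun _ => unifMeasure)).symm
  have hcomp := hpres.comp harr
  rw [← integral_pi_coinMeasure]
  refine Eq.trans ?_ (integral_prod _ (hcomp.integrable_comp_of_integrable hG))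
  conv_lhs => rw [← hcomp.map_eq]
  exact integral_map hcomp.aemeasurable (by rw [hcomp.map_eq]; exact hG.aestronglyMeasurable)

lemma integrable_eval_unifMeasure {ι : Type*} [Fintype ι] (i : ι) :
    Integrable (fun u : ι → ℝ => u i) (Measure.pi fun _ => unifMeasure) := by
  have : Integrable (fun x : ℝ => x) unifMeasure :=
    Integrable.smul_measure
      (continuous_id.integrableOn_Icc.mono_set Set.Ioc_subset_Icc_self).integrable (by simp)
  exact integrable_comp_eval (μ := fun _ : ι => unifMeasure) (i := i) this

lemma integrable_add_linear_unifMeasure {ι : Type*} [Fintype ι] (A : ℝ) (r : ι → ℝ) :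
    Integrable (fun u : ι → ℝ => A + ∑ i, r i * u i) (Measure.pi fun _ => unifMeasure) :=
  (integrable_const A).add
    (integrable_finsetSum _ fun i _ => (integrable_eval_unifMeasure i).const_mul (r i))

lemma integral_linear_unifMeasure {ι : Type*} [Fintype ι] (A : ℝ) (r : ι → ℝ) :
    ∫ u, (A + ∑ i, r i * u i) ∂(Measure.pi fun _ => unifMeasure) = A := by
  have h (i : ι) : ∫ u : ι → ℝ, u i ∂(Measure.pi fun _ => unifMeasure) = 0 := by
    rw [integral_comp_eval (μ := fun _ : ι => unifMeasure) (i := i) (f := fun x : ℝ => x)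
      aestronglyMeasurable_id, integral_unifMeasure]
    simp
  rw [integral_add (integrable_const A)
    (integrable_finsetSum _ fun i _ => (integrable_eval_unifMeasure i).const_mul (r i)),
    integral_finsetSum _ fun i _ => (integrable_eval_unifMeasure i).const_mul (r i)]
  simp [integral_const_mul, h]

/-- A Khintchine inequality for mixed sums of Rademacher and uniform variables, in which the
binary expansion of the uniform variables is truncated after `M` digits. -/
lemma mixed_khintchine {ι : Type} [Fintype ι] [DecidableEq ι] (M : ℕ) :
    ∀ (J : Type) [Fintype J] [DecidableEq J] (a : J → ℝ) (r : ι → ℝ),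
    (√2)⁻¹ * √(∑ j, a j ^ 2 + (∑ i, r i ^ 2) / 3 * (1 - (4 ^ M)⁻¹)) ≤
      (2 ^ Fintype.card J)⁻¹ * ∑ x : J → Bool,
        ∫ u, |∑ j, a j * boolSign (x j) + ∑ i, r i * u i| ∂(Measure.pi fun _ => unifMeasure) := by
  induction M with
  | zero =>
    intro J _ _ a r
    simp only [pow_zero, inv_one, sub_self, mul_zero, add_zero]
    refine (rademacher_khintchine a).trans ?_
    refine mul_le_mul_of_nonneg_left (Finset.sum_le_sum fun x _ => ?_) (by positivity)
    conv_lhs => rw [← integral_linear_unifMeasure (∑ j, a j * boolSign (x j)) r]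
    exact abs_integral_le_integral_abs
  | succ M ih =>
    intro J _ _ a r
    have h := ih (J ⊕ ι) (Sum.elim a fun i => r i / 2) (fun i => r i / 2)
    refine le_of_eq_of_le ?_ (h.trans_eq ?_)
    · simp only [Fintype.sum_sum_type, Sum.elim_inl, Sum.elim_inr, div_pow, ← Finset.sum_div]
      congr 2
      rw [pow_succ, mul_inv]
      ring
    · rw [← (Equiv.sumArrowEquivProdArrow J ι Bool).symm.sum_comp, Fintype.sum_prod_type,
        Fintype.card_sum, pow_add, mul_inv, mul_assoc, Finset.mul_sum]
      congr 1
      refine Finset.sum_congr rfl fun x _ => ?_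
      rw [integral_pi_unifMeasure_self_similar _ (integrable_add_linear_unifMeasure _ r).abs]
      congr 1
      refine Finset.sum_congr rfl fun e _ => ?_
      congr 1
      ext u
      simp only [Fintype.sum_sum_type, Sum.elim_inl, Sum.elim_inr,
        Equiv.sumArrowEquivProdArrow_symm_apply_inl, Equiv.sumArrowEquivProdArrow_symm_apply_inr,
        add_assoc, ← Finset.sum_add_distrib]
      congr 2
      refine Finset.sum_congr rfl fun i _ => by ring

/-- Khintchine's inequality for sums of independent uniform variables. -/
lemma uniform_khintchine {ι : Type} [Fintype ι] [DecidableEq ι] (r : ι → ℝ) :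
    (√6)⁻¹ * √(∑ i, r i ^ 2) ≤ ∫ u, |∑ i, r i * u i| ∂(Measure.pi fun _ => unifMeasure) := by
  have h (M : ℕ) := mixed_khintchine M Empty Empty.elim r
  simp only [Fintype.sum_empty, zero_add, Fintype.card_empty, pow_zero, inv_one, one_mul,
    Fintype.sum_unique] at h
  have hlim : Filter.Tendsto (fun M : ℕ => (√2)⁻¹ * √((∑ i, r i ^ 2) / 3 * (1 - (4 ^ M)⁻¹)))
      Filter.atTop (nhds ((√2)⁻¹ * √((∑ i, r i ^ 2) / 3 * (1 - 0)))) := by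
    have h4 : Filter.Tendsto (fun M : ℕ => ((4 : ℝ) ^ M)⁻¹) Filter.atTop (nhds 0) := by
      simpa using tendsto_pow_atTop_nhds_zero_of_lt_one (r := (4 : ℝ)⁻¹) (by norm_num) (by norm_num)
    exact ((h4.const_sub 1).const_mul _).sqrt.const_mul _
  have h6 : (√6)⁻¹ * √(∑ i, r i ^ 2) = (√2)⁻¹ * √((∑ i, r i ^ 2) / 3 * (1 - 0)) := by
    rw [← Real.sqrt_inv, ← Real.sqrt_inv, ← Real.sqrt_mul (by positivity),
      ← Real.sqrt_mul (by positivity)]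
    congr 1
    ring
  rw [h6]
  exact le_of_tendsto' hlim h

/-! ### Haar-random single-qubit states -/

/-- Probability measures on `[-1, 1]` are determined by their moments. -/
lemma measure_eq_of_moments_eq (P Q : Measure ℝ) [IsProbabilityMeasure P] [IsProbabilityMeasure Q]
    (hP : ∀ᵐ x ∂P, x ∈ Set.Icc (-1 : ℝ) 1) (hQ : ∀ᵐ x ∂Q, x ∈ Set.Icc (-1 : ℝ) 1)
    (hmom : ∀ m : ℕ, ∫ x, x ^ m ∂P = ∫ x, x ^ m ∂Q) : P = Q := by
  have hint (ν : Measure ℝ) [IsProbabilityMeasure ν] (hν : ∀ᵐ x ∂ν, x ∈ Set.Icc (-1 : ℝ) 1)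
      (m : ℕ) : Integrable (fun x : ℝ => x ^ m) ν := by
    refine Integrable.of_bound (by fun_prop) 1 ?_
    filter_upwards [hν] with x hx
    rw [norm_pow, Real.norm_eq_abs]
    exact pow_le_one₀ (abs_nonneg _) (abs_le.2 hx)
  have hpoly (ν : Measure ℝ) [IsProbabilityMeasure ν] (hν : ∀ᵐ x ∂ν, x ∈ Set.Icc (-1 : ℝ) 1)
      (p : Polynomial ℝ) : Integrable (fun x => p.eval x) ν ∧
        ∫ x, p.eval x ∂ν = ∑ i ∈ Finset.range (p.natDegree + 1), p.coeff i * ∫ x, x ^ i ∂ν := by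
    simp only [Polynomial.eval_eq_sum_range]
    refine ⟨integrable_finsetSum _ fun i _ => (hint ν hν i).const_mul _, ?_⟩
    rw [integral_finsetSum _ fun i _ => (hint ν hν i).const_mul _]
    simp only [integral_const_mul]
  refine ext_of_forall_integral_eq_of_IsFiniteMeasure fun f => ?_
  refine eq_of_forall_dist_le fun ε hε => ?_
  obtain ⟨p, hp⟩ := exists_polynomial_near_of_continuousOn (-1) 1 f f.continuous.continuousOn
    (ε / 2) (by positivity)
  have hclose (ν : Measure ℝ) [IsProbabilityMeasure ν] (hν : ∀ᵐ x ∂ν, x ∈ Set.Icc (-1 : ℝ) 1) :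
      dist (∫ x, f x ∂ν) (∫ x, p.eval x ∂ν) ≤ ε / 2 := by
    rw [dist_eq_norm, ← integral_sub (f.integrable ν) (hpoly ν hν p).1]
    refine (norm_integral_le_of_norm_le_const (C := ε / 2) ?_).trans_eq (by simp)
    filter_upwards [hν] with x hx
    rw [norm_sub_rev]
    exact (hp x hx).le
  have hPQ : ∫ x, p.eval x ∂P = ∫ x, p.eval x ∂Q := by
    simp only [(hpoly P hP p).2, (hpoly Q hQ p).2, hmom]
  calc dist (∫ x, f x ∂P) (∫ x, f x ∂Q)
      ≤ dist (∫ x, f x ∂P) (∫ x, p.eval x ∂P) + dist (∫ x, f x ∂Q) (∫ x, p.eval x ∂P) :=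
        dist_triangle_right _ _ _
    _ ≤ ε / 2 + ε / 2 := add_le_add (hclose P hP) (hPQ ▸ hclose Q hQ)
    _ = ε := add_halves ε

/-- Integration by parts for a pair of bounded variables whose joint moments are invariant under
rotations. -/
lemma moment_identity_of_rotation_invariant {Ω : Type*} [MeasurableSpace Ω] (μ : Measure Ω)
    [IsProbabilityMeasure μ] (Z X : Ω → ℝ) (hZm : Measurable Z) (hXm : Measurable X)
    (hZ : ∀ᵐ ω ∂μ, |Z ω| ≤ 1) (hX : ∀ᵐ ω ∂μ, |X ω| ≤ 1) (m : ℕ)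
    (hrot : ∀ θ : ℝ, ∫ ω, (Real.cos θ * Z ω - Real.sin θ * X ω) ^ m *
      (Real.sin θ * Z ω + Real.cos θ * X ω) ∂μ = ∫ ω, Z ω ^ m * X ω ∂μ) :
    ∫ ω, Z ω ^ (m + 1) ∂μ = m * ∫ ω, Z ω ^ (m - 1) * X ω ^ 2 ∂μ := by
  have hbd (a b : ℝ) (ha : |a| ≤ 1) (hb : |b| ≤ 1) (z x : ℝ) (hz : |z| ≤ 1) (hx : |x| ≤ 1) :
      |a * z + b * x| ≤ 2 := by
    refine (abs_add_le _ _).trans ?_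
    rw [abs_mul, abs_mul]
    nlinarith [abs_nonneg a, abs_nonneg b, abs_nonneg z, abs_nonneg x]
  have hA (θ : ℝ) : ∀ᵐ ω ∂μ, |Real.cos θ * Z ω - Real.sin θ * X ω| ≤ 2 := by
    filter_upwards [hZ, hX] with ω h1 h2
    have := hbd (Real.cos θ) (-Real.sin θ) (Real.abs_cos_le_one θ)
      (by rw [abs_neg]; exact Real.abs_sin_le_one θ) _ _ h1 h2
    rwa [neg_mul, ← sub_eq_add_neg] at this
  let F : ℝ → Ω → ℝ := fun θ ω => (Real.cos θ * Z ω - Real.sin θ * X ω) ^ m *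
      (Real.sin θ * Z ω + Real.cos θ * X ω)
  let F' : ℝ → Ω → ℝ := fun θ ω => m * (Real.cos θ * Z ω - Real.sin θ * X ω) ^ (m - 1) *
      (-(Real.sin θ * Z ω + Real.cos θ * X ω)) * (Real.sin θ * Z ω + Real.cos θ * X ω) +
      (Real.cos θ * Z ω - Real.sin θ * X ω) ^ m * (Real.cos θ * Z ω - Real.sin θ * X ω)
  have hF : ∀ θ, Measurable (F θ) := fun θ => by fun_prop
  have hF' : ∀ θ, Measurable (F' θ) := fun θ => by fun_prop
  have hFint : Integrable (F 0) μ := by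
    refine Integrable.of_bound (hF 0).aestronglyMeasurable 1 ?_
    filter_upwards [hZ, hX] with ω h1 h2
    simp only [F, Real.cos_zero, Real.sin_zero, one_mul, zero_mul, sub_zero, zero_add,
      Real.norm_eq_abs, abs_mul, abs_pow]
    exact mul_le_one₀ (pow_le_one₀ (abs_nonneg _) h1) (abs_nonneg _) h2
  have hbound : ∀ᵐ ω ∂μ, ∀ θ ∈ (Set.univ : Set ℝ),
      ‖F' θ ω‖ ≤ m * 2 ^ (m - 1) * 2 * 2 + 2 ^ m * 2 := by
    filter_upwards [hZ, hX] with ω h1 h2 θ _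
    have hc := Real.abs_cos_le_one θ
    have hs := Real.abs_sin_le_one θ
    have hB := hbd _ _ hs hc _ _ h1 h2
    have hA : |Real.cos θ * Z ω - Real.sin θ * X ω| ≤ 2 := by
      have := hbd (Real.cos θ) (-Real.sin θ) hc (by rwa [abs_neg]) _ _ h1 h2
      rwa [neg_mul, ← sub_eq_add_neg] at this
    refine (norm_add_le _ _).trans ?_
    simp only [norm_mul, norm_pow, norm_neg, Real.norm_eq_abs, Nat.abs_cast]
    gcongr
  have hdiff : ∀ᵐ ω ∂μ, ∀ θ ∈ (Set.univ : Set ℝ), HasDerivAt (F · ω) (F' θ ω) θ := by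
    refine ae_of_all _ fun ω θ _ => ?_
    have hA : HasDerivAt (fun θ => Real.cos θ * Z ω - Real.sin θ * X ω)
        (-(Real.sin θ * Z ω + Real.cos θ * X ω)) θ := by
      exact (((Real.hasDerivAt_cos θ).mul_const (Z ω)).sub
        ((Real.hasDerivAt_sin θ).mul_const (X ω))).congr_deriv (by ring)
    have hB : HasDerivAt (fun θ => Real.sin θ * Z ω + Real.cos θ * X ω)
        (Real.cos θ * Z ω - Real.sin θ * X ω) θ := by
      exact (((Real.hasDerivAt_sin θ).mul_const (Z ω)).add
        ((Real.hasDerivAt_cos θ).mul_const (X ω))).congr_deriv (by ring)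
    exact (hA.pow m).mul hB
  obtain ⟨-, hd⟩ := hasDerivAt_integral_of_dominated_loc_of_deriv_le (μ := μ) (F := F) (F' := F')
    (x₀ := 0) Filter.univ_mem (Filter.Eventually.of_forall fun θ => (hF θ).aestronglyMeasurable)
    hFint (hF' 0).aestronglyMeasurable hbound (integrable_const _) hdiff
  have hconst : (fun θ => ∫ ω, F θ ω ∂μ) = fun _ => ∫ ω, Z ω ^ m * X ω ∂μ := funext hrot
  rw [hconst] at hd
  have h0 := hd.unique (hasDerivAt_const _ _)
  have i1 : Integrable (fun ω => Z ω ^ (m + 1)) μ := by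
    refine Integrable.of_bound (by fun_prop) 1 ?_
    filter_upwards [hZ] with ω h1
    rw [norm_pow]
    exact pow_le_one₀ (norm_nonneg _) h1
  have i2 : Integrable (fun ω => Z ω ^ (m - 1) * X ω ^ 2) μ := by
    refine Integrable.of_bound (by fun_prop) 1 ?_
    filter_upwards [hZ, hX] with ω h1 h2
    rw [norm_mul, norm_pow, norm_pow]
    exact mul_le_one₀ (pow_le_one₀ (norm_nonneg _) h1) (by positivity)
      (pow_le_one₀ (norm_nonneg _) h2)
  have h1 : ∫ ω, F' 0 ω ∂μ = ∫ ω, (Z ω ^ (m + 1) - m * (Z ω ^ (m - 1) * X ω ^ 2)) ∂μ := by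
    congr 1
    ext ω
    simp only [F', Real.cos_zero, Real.sin_zero]
    ring
  rw [h1, integral_sub i1 (i2.const_mul _), integral_const_mul] at h0
  linarith

/-- The expectation `⟨ψ|M|ψ⟩` in the state `|ψ⟩ = U|0⟩`. -/
noncomputable def qubitExpect (M U : Matrix (Fin 2) (Fin 2) ℂ) : ℂ := (Uᴴ * M * U) 0 0

/-- The coordinates of the Bloch vector of the state `U|0⟩`. -/
noncomputable def blochCoord (a : Fin 3) (U : Matrix (Fin 2) (Fin 2) ℂ) : ℝ :=
  (qubitExpect (pauli a.succ) U).re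

lemma measurable_matrix_entry (i j : Fin 2) :
    Measurable fun U : Matrix (Fin 2) (Fin 2) ℂ => U i j :=
  (measurable_pi_apply j).comp (measurable_pi_apply i)

lemma measurable_matrix_mul_left (V : Matrix (Fin 2) (Fin 2) ℂ) :
    Measurable fun U : Matrix (Fin 2) (Fin 2) ℂ => V * U := by
  refine measurable_pi_iff.2 fun i => measurable_pi_iff.2 fun j => ?_
  simp only [Matrix.mul_apply]
  exact Finset.measurable_sum _ fun l _ => (measurable_matrix_entry l j).const_mul _

lemma blochCoord_zero (U : Matrix (Fin 2) (Fin 2) ℂ) :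
    blochCoord 0 U = 2 * ((U 0 0).re * (U 1 0).re + (U 0 0).im * (U 1 0).im) := by
  simp [blochCoord, qubitExpect, pauli, Matrix.mul_apply, Fin.sum_univ_two]
  ring

lemma blochCoord_one (U : Matrix (Fin 2) (Fin 2) ℂ) :
    blochCoord 1 U = 2 * ((U 0 0).re * (U 1 0).im - (U 0 0).im * (U 1 0).re) := by
  simp [blochCoord, qubitExpect, pauli, Matrix.mul_apply, Fin.sum_univ_two]
  ring

lemma blochCoord_two (U : Matrix (Fin 2) (Fin 2) ℂ) :
    blochCoord 2 U = (U 0 0).re ^ 2 + (U 0 0).im ^ 2 - ((U 1 0).re ^ 2 + (U 1 0).im ^ 2) := by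
  simp [blochCoord, qubitExpect, pauli, Matrix.mul_apply, Fin.sum_univ_two]
  ring

lemma measurable_blochCoord (a : Fin 3) : Measurable (blochCoord a) := by
  have hr (i : Fin 2) : Measurable fun U : Matrix (Fin 2) (Fin 2) ℂ => (U i 0).re :=
    Complex.measurable_re.comp (measurable_matrix_entry i 0)
  have hi (i : Fin 2) : Measurable fun U : Matrix (Fin 2) (Fin 2) ℂ => (U i 0).im :=
    Complex.measurable_im.comp (measurable_matrix_entry i 0)
  have h0 := hr 0
  have h1 := hr 1
  have h2 := hi 0
  have h3 := hi 1
  fin_cases a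
  · simp only [Fin.zero_eta, funext blochCoord_zero]
    fun_prop
  · simp only [Fin.mk_one, funext blochCoord_one]
    fun_prop
  · simp only [Fin.reduceFinMk, funext blochCoord_two]
    fun_prop

lemma column_norm_of_unitary {U : Matrix (Fin 2) (Fin 2) ℂ}
    (hU : U ∈ unitary (Matrix (Fin 2) (Fin 2) ℂ)) :
    (U 0 0).re ^ 2 + (U 0 0).im ^ 2 + ((U 1 0).re ^ 2 + (U 1 0).im ^ 2) = 1 := by
  have h := congrFun (congrFun (Unitary.mem_iff.1 hU).1 0) 0
  have h2 := congrArg Complex.re h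
  simp [Matrix.mul_apply, Fin.sum_univ_two, Matrix.star_eq_conjTranspose] at h2
  linarith

lemma sum_blochCoord_sq {U : Matrix (Fin 2) (Fin 2) ℂ}
    (hU : U ∈ unitary (Matrix (Fin 2) (Fin 2) ℂ)) :
    blochCoord 0 U ^ 2 + blochCoord 1 U ^ 2 + blochCoord 2 U ^ 2 = 1 := by
  have h := column_norm_of_unitary hU
  rw [blochCoord_zero, blochCoord_one, blochCoord_two]
  linear_combination ((U 0 0).re ^ 2 + (U 0 0).im ^ 2 + ((U 1 0).re ^ 2 + (U 1 0).im ^ 2) + 1) * h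

lemma abs_blochCoord_le {U : Matrix (Fin 2) (Fin 2) ℂ}
    (hU : U ∈ unitary (Matrix (Fin 2) (Fin 2) ℂ)) (a : Fin 3) : |blochCoord a U| ≤ 1 := by
  have h := sum_blochCoord_sq hU
  refine abs_le_one_iff_mul_self_le_one.2 ?_
  fin_cases a <;>
  · simp only [Fin.zero_eta, Fin.mk_one, Fin.reduceFinMk]
    nlinarith [sq_nonneg (blochCoord 0 U), sq_nonneg (blochCoord 1 U), sq_nonneg (blochCoord 2 U)]

lemma integral_comp_unitary_mul {μ : Measure (Matrix (Fin 2) (Fin 2) ℂ)}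
    (hinv : ∀ V ∈ unitary (Matrix (Fin 2) (Fin 2) ℂ), Measure.map (fun U => V * U) μ = μ)
    {V : Matrix (Fin 2) (Fin 2) ℂ} (hV : V ∈ unitary (Matrix (Fin 2) (Fin 2) ℂ))
    {f : Matrix (Fin 2) (Fin 2) ℂ → ℝ} (hf : Measurable f) :
    ∫ U, f (V * U) ∂μ = ∫ U, f U ∂μ := by
  conv_rhs => rw [← hinv V hV]
  rw [integral_map (measurable_matrix_mul_left V).aemeasurable hf.aestronglyMeasurable]

lemma integral_blochCoord_zero_sq_eq_one_sq {μ : Measure (Matrix (Fin 2) (Fin 2) ℂ)}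
    (hinv : ∀ V ∈ unitary (Matrix (Fin 2) (Fin 2) ℂ), Measure.map (fun U => V * U) μ = μ) (m : ℕ) :
    ∫ U, blochCoord 2 U ^ m * blochCoord 0 U ^ 2 ∂μ =
      ∫ U, blochCoord 2 U ^ m * blochCoord 1 U ^ 2 ∂μ := by
  let V : Matrix (Fin 2) (Fin 2) ℂ := !![1, 0; 0, Complex.I]
  have hV : V ∈ unitary (Matrix (Fin 2) (Fin 2) ℂ) := by
    refine Matrix.mem_unitaryGroup_iff.2 ?_
    ext i j
    fin_cases i <;> fin_cases j <;>
      simp [V, Matrix.mul_apply, Fin.sum_univ_two, Matrix.star_eq_conjTranspose]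
  have hz (U : Matrix (Fin 2) (Fin 2) ℂ) : blochCoord 2 (V * U) = blochCoord 2 U := by
    rw [blochCoord_two, blochCoord_two]
    simp [V, Matrix.mul_apply, Fin.sum_univ_two]
    ring
  have hy (U : Matrix (Fin 2) (Fin 2) ℂ) : blochCoord 1 (V * U) = blochCoord 0 U := by
    rw [blochCoord_one, blochCoord_zero]
    simp [V, Matrix.mul_apply, Fin.sum_univ_two]
  have := integral_comp_unitary_mul hinv hV
    (((measurable_blochCoord 2).pow_const m).mul ((measurable_blochCoord 1).pow_const 2))
  simpa only [Pi.mul_apply, hz, hy] using this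

section Haar

variable {μ : Measure (Matrix (Fin 2) (Fin 2) ℂ)} [IsProbabilityMeasure μ]

lemma moment_recursion_blochCoord_two
    (hunit : ∀ᵐ U ∂μ, U ∈ unitary (Matrix (Fin 2) (Fin 2) ℂ))
    (hinv : ∀ V ∈ unitary (Matrix (Fin 2) (Fin 2) ℂ), Measure.map (fun U => V * U) μ = μ) (m : ℕ) :
    ∫ U, blochCoord 2 U ^ (m + 1) ∂μ =
      m * ∫ U, blochCoord 2 U ^ (m - 1) * blochCoord 0 U ^ 2 ∂μ := by
  refine moment_identity_of_rotation_invariant μ _ _ (measurable_blochCoord 2)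
    (measurable_blochCoord 0) (hunit.mono fun U hU => abs_blochCoord_le hU 2)
    (hunit.mono fun U hU => abs_blochCoord_le hU 0) m fun θ => ?_
  let V : Matrix (Fin 2) (Fin 2) ℂ := !![(Real.cos (θ / 2) : ℂ), -(Real.sin (θ / 2) : ℂ);
    (Real.sin (θ / 2) : ℂ), (Real.cos (θ / 2) : ℂ)]
  have hsc : (Real.sin (θ / 2) : ℂ) ^ 2 + (Real.cos (θ / 2) : ℂ) ^ 2 = 1 := by
    exact_mod_cast Real.sin_sq_add_cos_sq (θ / 2)
  have hV : V ∈ unitary (Matrix (Fin 2) (Fin 2) ℂ) := by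
    refine Matrix.mem_unitaryGroup_iff.2 ?_
    ext i j
    fin_cases i <;> fin_cases j <;>
      simp [V, Matrix.mul_apply, Fin.sum_univ_two, Matrix.star_eq_conjTranspose,
        -Complex.ofReal_sin, -Complex.ofReal_cos] <;> first | linear_combination hsc | ring
  have hcos : Real.cos θ = Real.cos (θ / 2) ^ 2 - Real.sin (θ / 2) ^ 2 := by
    rw [← Real.cos_two_mul', mul_div_cancel₀ θ two_ne_zero]
  have hsin : Real.sin θ = 2 * Real.sin (θ / 2) * Real.cos (θ / 2) := by
    rw [← Real.sin_two_mul, mul_div_cancel₀ θ two_ne_zero]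
  have hz (U : Matrix (Fin 2) (Fin 2) ℂ) :
      blochCoord 2 (V * U) = Real.cos θ * blochCoord 2 U - Real.sin θ * blochCoord 0 U := by
    rw [blochCoord_two, blochCoord_two, blochCoord_zero, hcos, hsin]
    simp [V, Matrix.mul_apply, Fin.sum_univ_two, -Complex.ofReal_sin, -Complex.ofReal_cos]
    ring
  have hx (U : Matrix (Fin 2) (Fin 2) ℂ) :
      blochCoord 0 (V * U) = Real.sin θ * blochCoord 2 U + Real.cos θ * blochCoord 0 U := by
    rw [blochCoord_two, blochCoord_zero, blochCoord_zero, hcos, hsin]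
    simp [V, Matrix.mul_apply, Fin.sum_univ_two, -Complex.ofReal_sin, -Complex.ofReal_cos]
    ring
  have := integral_comp_unitary_mul hinv hV
    (((measurable_blochCoord 2).pow_const m).mul (measurable_blochCoord 0))
  simpa only [Pi.mul_apply, hz, hx] using this

lemma integrable_blochCoord_two_pow (hunit : ∀ᵐ U ∂μ, U ∈ unitary (Matrix (Fin 2) (Fin 2) ℂ))
    (a : Fin 3) (m : ℕ) (l : ℕ) :
    Integrable (fun U => blochCoord 2 U ^ m * blochCoord a U ^ l) μ := by
  refine Integrable.of_bound (((measurable_blochCoord 2).pow_const m).mul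
    ((measurable_blochCoord a).pow_const l)).aestronglyMeasurable 1 ?_
  filter_upwards [hunit] with U hU
  rw [norm_mul, norm_pow, norm_pow]
  exact mul_le_one₀ (pow_le_one₀ (norm_nonneg _) (abs_blochCoord_le hU 2)) (by positivity)
    (pow_le_one₀ (norm_nonneg _) (abs_blochCoord_le hU a))

lemma integral_pow_unifMeasure (m : ℕ) :
    ∫ x, x ^ m ∂unifMeasure = 2⁻¹ * ((1 - (-1) ^ (m + 1)) / (m + 1)) := by
  rw [integral_unifMeasure, integral_pow]
  simp

/-- The moments of a Bloch coordinate agree with those of the uniform distribution. -/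
lemma moment_blochCoord_two (hunit : ∀ᵐ U ∂μ, U ∈ unitary (Matrix (Fin 2) (Fin 2) ℂ))
    (hinv : ∀ V ∈ unitary (Matrix (Fin 2) (Fin 2) ℂ), Measure.map (fun U => V * U) μ = μ) :
    ∀ m : ℕ, ∫ U, blochCoord 2 U ^ m ∂μ = ∫ x, x ^ m ∂unifMeasure
  | 0 => by simp
  | 1 => by
    have := moment_recursion_blochCoord_two hunit hinv 0
    rw [integral_pow_unifMeasure]
    simpa using this
  | m + 2 => by
    have ih := moment_blochCoord_two hunit hinv m
    have h0 := moment_recursion_blochCoord_two hunit hinv (m + 1)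
    have h1 := integral_blochCoord_zero_sq_eq_one_sq hinv m
    have hsum : ∫ U, blochCoord 2 U ^ m * blochCoord 0 U ^ 2 ∂μ +
        ∫ U, blochCoord 2 U ^ m * blochCoord 1 U ^ 2 ∂μ =
        ∫ U, blochCoord 2 U ^ m ∂μ - ∫ U, blochCoord 2 U ^ (m + 2) ∂μ := by
      have i0 := integrable_blochCoord_two_pow hunit 0 m 0
      have i2 := integrable_blochCoord_two_pow hunit 0 (m + 2) 0
      simp only [pow_zero, mul_one] at i0 i2
      rw [← integral_add (integrable_blochCoord_two_pow hunit 0 m 2)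
        (integrable_blochCoord_two_pow hunit 1 m 2), ← integral_sub i0 i2]
      refine integral_congr_ae ?_
      filter_upwards [hunit] with U hU
      linear_combination blochCoord 2 U ^ m * sum_blochCoord_sq hU
    rw [integral_pow_unifMeasure] at ih ⊢
    simp only [add_tsub_cancel_right, Nat.cast_add, Nat.cast_one] at h0
    have h3 : ((m : ℝ) + 3) * ∫ U, blochCoord 2 U ^ (m + 2) ∂μ =
        (m + 1) * ∫ U, blochCoord 2 U ^ m ∂μ := by
      linear_combination 2 * h0 + (m + 1 : ℝ) * hsum + (m + 1 : ℝ) * h1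
    rw [ih] at h3
    have hm1 : (m : ℝ) + 1 ≠ 0 := by positivity
    have hm3 : (m : ℝ) + 3 ≠ 0 := by positivity
    rw [← mul_right_inj' hm3, h3]
    push_cast
    rw [show (m : ℝ) + 2 + 1 = m + 3 by ring]
    field_simp
    ring

lemma map_blochCoord_two (hunit : ∀ᵐ U ∂μ, U ∈ unitary (Matrix (Fin 2) (Fin 2) ℂ))
    (hinv : ∀ V ∈ unitary (Matrix (Fin 2) (Fin 2) ℂ), Measure.map (fun U => V * U) μ = μ) :
    μ.map (blochCoord 2) = unifMeasure := by
  have hm := measurable_blochCoord 2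
  have := Measure.isProbabilityMeasure_map (μ := μ) hm.aemeasurable
  refine measure_eq_of_moments_eq _ _ ?_ ?_ fun m => ?_
  · refine (ae_map_iff hm.aemeasurable (p := fun x => x ∈ Set.Icc (-1 : ℝ) 1)
      measurableSet_Icc).2 ?_
    exact hunit.mono fun U hU => abs_le.1 (abs_blochCoord_le hU 2)
  · refine Measure.ae_smul_measure ?_ _
    filter_upwards [ae_restrict_mem measurableSet_Ioc] with x hx
    exact Set.Ioc_subset_Icc_self hx
  · rw [integral_map hm.aemeasurable (by fun_prop)]
    exact moment_blochCoord_two hunit hinv m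

/-- Every direction on the Bloch sphere is the image of the `Z` axis under a unitary. -/
lemma exists_unitary_blochCoord (w : Fin 3 → ℝ) :
    ∃ V ∈ unitary (Matrix (Fin 2) (Fin 2) ℂ), ∃ r : ℝ, r ^ 2 = ∑ a, w a ^ 2 ∧
      ∀ U, ∑ a, w a * blochCoord a U = r * blochCoord 2 (V * U) := by
  set H : Matrix (Fin 2) (Fin 2) ℂ := ∑ a, (w a : ℂ) • pauli a.succ with hHdef
  have hHe : H = !![(w 2 : ℂ), w 0 - w 1 * Complex.I; w 0 + w 1 * Complex.I, -w 2] := by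
    ext i j
    fin_cases i <;> fin_cases j <;>
      simp [hHdef, Fin.sum_univ_three, pauli, sub_eq_add_neg]
  have hH : H.IsHermitian := by
    rw [hHe]
    ext i j
    fin_cases i <;> fin_cases j <;> simp [sub_eq_add_neg]
  have hspec := hH.spectral_theorem
  have htr := hH.trace_eq_sum_eigenvalues
  have hdet := hH.det_eq_prod_eigenvalues
  replace htr := (congrArg Matrix.trace hHe).symm.trans htr
  replace hdet := (congrArg Matrix.det hHe).symm.trans hdet
  simp only [Matrix.trace_fin_two_of, Fin.sum_univ_two, Matrix.det_fin_two_of,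
    Fin.prod_univ_two] at htr hdet
  set r := hH.eigenvalues 0 with hr
  have h1 : hH.eigenvalues 1 = -r := by
    have : (r : ℂ) + (hH.eigenvalues 1 : ℂ) = 0 := by simpa using htr.symm
    have : r + hH.eigenvalues 1 = 0 := by exact_mod_cast this
    linarith
  refine ⟨star (hH.eigenvectorUnitary : Matrix (Fin 2) (Fin 2) ℂ),
    Unitary.star_mem hH.eigenvectorUnitary.2, r, ?_, fun U => ?_⟩
  · rw [h1] at hdet
    have : ((r ^ 2 : ℝ) : ℂ) = ((∑ a, w a ^ 2 : ℝ) : ℂ) := by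
      simp only [Fin.sum_univ_three]
      push_cast at hdet ⊢
      linear_combination hdet - (w 1 : ℂ) ^ 2 * Complex.I_sq
    exact_mod_cast this
  · have hdiag : Matrix.diagonal (RCLike.ofReal ∘ hH.eigenvalues) = (r : ℂ) • pauli 3 := by
      ext i j
      fin_cases i <;> fin_cases j <;> simp [pauli, h1, hr]
    rw [hdiag, Unitary.conjStarAlgAut_apply] at hspec
    have hleft : ∑ a, w a * blochCoord a U = (qubitExpect H U).re := by
      simp [hHdef, qubitExpect, blochCoord, Fin.sum_univ_three, Matrix.mul_add, Matrix.add_mul]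
    refine hleft.trans ((congrArg (fun M => (qubitExpect M U).re) hspec).trans ?_)
    simp only [blochCoord, qubitExpect, Matrix.conjTranspose_mul, Matrix.star_eq_conjTranspose,
      Matrix.conjTranspose_conjTranspose, Matrix.mul_assoc, Matrix.smul_mul, Matrix.mul_smul,
      Matrix.smul_apply]
    simp

lemma map_bloch_direction (hunit : ∀ᵐ U ∂μ, U ∈ unitary (Matrix (Fin 2) (Fin 2) ℂ))
    (hinv : ∀ V ∈ unitary (Matrix (Fin 2) (Fin 2) ℂ), Measure.map (fun U => V * U) μ = μ)
    (w : Fin 3 → ℝ) : ∃ r : ℝ, r ^ 2 = ∑ a, w a ^ 2 ∧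
      μ.map (fun U => ∑ a, w a * blochCoord a U) = unifMeasure.map (fun x => r * x) := by
  obtain ⟨V, hV, r, hr, h⟩ := exists_unitary_blochCoord w
  refine ⟨r, hr, ?_⟩
  rw [← map_blochCoord_two hunit hinv, Measure.map_map (by fun_prop) (measurable_blochCoord 2)]
  conv_rhs => rw [← hinv V hV]
  rw [Measure.map_map ((measurable_const_mul r).comp (measurable_blochCoord 2))
    (measurable_matrix_mul_left V)]
  simp only [h]
  rfl

/-- Khintchine's inequality for linear forms in independent Haar-random Bloch vectors. -/
lemma bloch_khintchine (hunit : ∀ᵐ U ∂μ, U ∈ unitary (Matrix (Fin 2) (Fin 2) ℂ))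
    (hinv : ∀ V ∈ unitary (Matrix (Fin 2) (Fin 2) ℂ), Measure.map (fun U => V * U) μ = μ)
    {n : ℕ} (w : Fin n × Fin 3 → ℝ) :
    (√6)⁻¹ * √(∑ j, w j ^ 2) ≤
      ∫ U, |∑ j, w j * blochCoord j.2 (U j.1)| ∂(Measure.pi fun _ : Fin n => μ) := by
  choose r hr hmap using fun i => map_bloch_direction hunit hinv fun a => w (i, a)
  have hm (i : Fin n) : Measurable fun U => ∑ a, w (i, a) * blochCoord a U :=
    Finset.measurable_sum _ fun a _ => (measurable_blochCoord a).const_mul _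
  have hprob (i : Fin n) := Measure.isProbabilityMeasure_map (μ := μ) (hm i).aemeasurable
  have hprob' (i : Fin n) := Measure.isProbabilityMeasure_map (μ := unifMeasure)
    (f := fun x => r i * x) (by fun_prop)
  have h1 := Measure.pi_map_pi (μ := fun _ : Fin n => μ) fun i => (hm i).aemeasurable
  have h2 := Measure.pi_map_pi (μ := fun _ : Fin n => unifMeasure) (f := fun i x => r i * x)
    fun i => by fun_prop
  simp only [hmap] at h1
  rw [← h2] at h1
  have hsum : ∑ j, w j ^ 2 = ∑ i, r i ^ 2 := by
    simp only [hr, Fintype.sum_prod_type]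
  rw [hsum]
  refine (uniform_khintchine r).trans_eq ?_
  have hcont : Continuous fun v : Fin n → ℝ => |∑ i, v i| := by fun_prop
  have h3 := congrArg (fun ν => ∫ v, |∑ i, v i| ∂ν) h1
  have hm1 : Measurable fun (U : Fin n → Matrix (Fin 2) (Fin 2) ℂ) i =>
      ∑ a, w (i, a) * blochCoord a (U i) :=
    measurable_pi_iff.2 fun i => (hm i).comp (measurable_pi_apply i)
  have hm2 : Measurable fun (u : Fin n → ℝ) i => r i * u i := by fun_prop
  rw [integral_map hm1.aemeasurable hcont.aestronglyMeasurable,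
    integral_map hm2.aemeasurable hcont.aestronglyMeasurable] at h3
  rw [← h3]
  simp only [Fintype.sum_prod_type]

end Haar

/-! ### Tensorization -/

/-- Minkowski's integral inequality for the Euclidean norm. -/
lemma sqrt_sum_integral_abs_sq_le {Ω J : Type*} [MeasurableSpace Ω] [Fintype J] {ν : Measure Ω}
    {T : J → Ω → ℝ} (hT : ∀ j, Integrable (T j) ν)
    (hnorm : Integrable (fun ω => √(∑ j, T j ω ^ 2)) ν) :
    √(∑ j, (∫ ω, |T j ω| ∂ν) ^ 2) ≤ ∫ ω, √(∑ j, T j ω ^ 2) ∂ν := by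
  set m : J → ℝ := fun j => ∫ ω, |T j ω| ∂ν
  have hsq : √(∑ j, m j ^ 2) * √(∑ j, m j ^ 2) ≤
      √(∑ j, m j ^ 2) * ∫ ω, √(∑ j, T j ω ^ 2) ∂ν := by
    rw [Real.mul_self_sqrt (by positivity), ← integral_const_mul]
    calc ∑ j, m j ^ 2 = ∫ ω, ∑ j, m j * |T j ω| ∂ν := by
          rw [integral_finsetSum _ fun j _ => (hT j).abs.const_mul _]
          simp only [integral_const_mul, m, sq]
      _ ≤ ∫ ω, √(∑ j, m j ^ 2) * √(∑ j, T j ω ^ 2) ∂ν := by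
          refine integral_mono (integrable_finsetSum _ fun j _ => (hT j).abs.const_mul _)
            (hnorm.const_mul _) fun ω => ?_
          simpa only [sq_abs] using
            Real.sum_mul_le_sqrt_mul_sqrt Finset.univ m fun j => |T j ω|
  rcases (Real.sqrt_nonneg (∑ j, m j ^ 2)).eq_or_lt with h | h
  · rw [← h]
    exact integral_nonneg fun ω => Real.sqrt_nonneg _
  · exact le_of_mul_le_mul_left hsq h

lemma integrable_sqrt_sum_sq {Ω J : Type*} [MeasurableSpace Ω] [Fintype J] {ν : Measure Ω}
    {T : J → Ω → ℝ} (hT : ∀ j, Integrable (T j) ν) :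
    Integrable (fun ω => √(∑ j, T j ω ^ 2)) ν := by
  refine (integrable_finsetSum Finset.univ fun j _ => (hT j).abs).mono' ?_
    (ae_of_all _ fun ω => ?_)
  · refine Real.continuous_sqrt.comp_aestronglyMeasurable ?_
    exact Finset.aestronglyMeasurable_fun_sum _ fun j _ => (hT j).aestronglyMeasurable.pow 2
  · rw [Real.norm_of_nonneg (Real.sqrt_nonneg _)]
    refine Real.sqrt_le_iff.2 ⟨by positivity, ?_⟩
    simpa only [sq_abs] using
      Finset.sum_sq_le_sq_sum_of_nonneg (s := Finset.univ) fun j _ => abs_nonneg (T j ω)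

/-- A Khintchine-type inequality for linear forms extends to multilinear forms in independent
copies, with the corresponding power of the constant. -/
lemma khintchine_tensor {Ω J : Type*} [MeasurableSpace Ω] [Fintype J] (ν : Measure Ω)
    [IsProbabilityMeasure ν] (Y : J → Ω → ℝ) (hY : ∀ j, Integrable (Y j) ν) {C : ℝ} (hC : 0 ≤ C)
    (hlin : ∀ w : J → ℝ, C * √(∑ j, w j ^ 2) ≤ ∫ ω, |∑ j, w j * Y j ω| ∂ν) :
    ∀ (k : ℕ) (c : (Fin k → J) → ℝ), C ^ k * √(∑ l, c l ^ 2) ≤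
      ∫ ω, |∑ l, c l * ∏ s, Y (l s) (ω s)| ∂(Measure.pi fun _ : Fin k => ν) := by
  intro k
  induction k with
  | zero =>
    intro c
    simp [Real.sqrt_sq_eq_abs]
  | succ k ih =>
    intro c
    set νk : Measure (Fin k → Ω) := Measure.pi fun _ => ν
    let T : J → (Fin k → Ω) → ℝ := fun j τ =>
      ∑ l : Fin k → J, c (Fin.cons j l) * ∏ s, Y (l s) (τ s)
    have hT (j : J) : Integrable (T j) νk :=
      integrable_finsetSum _ fun l _ => (Integrable.fintype_prod fun s => hY (l s)).const_mul _
    have hsum {M : Type} [AddCommMonoid M] (f : (Fin (k + 1) → J) → M) :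
        ∑ l, f l = ∑ j, ∑ l : Fin k → J, f (Fin.cons j l) := by
      rw [← Fintype.sum_prod_type']
      exact ((Fin.consEquiv fun _ => J).sum_comp f).symm
    have hmp := (measurePreserving_piFinSuccAbove (fun _ : Fin (k + 1) => ν) 0).symm
    have hint : Integrable (fun z : Ω × (Fin k → Ω) => |∑ j, T j z.2 * Y j z.1|) (ν.prod νk) := by
      refine (integrable_finsetSum _ fun j _ => ?_).abs
      simpa only [mul_comm] using (hY j).mul_prod (hT j)
    have hnorm := integrable_sqrt_sum_sq hT
    calc C ^ (k + 1) * √(∑ l, c l ^ 2)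
        = C * √(∑ j, (C ^ k * √(∑ l : Fin k → J, c (Fin.cons j l) ^ 2)) ^ 2) := by
          simp only [mul_pow, ← Finset.mul_sum]
          rw [Real.sqrt_mul (by positivity), Real.sqrt_sq (by positivity), hsum, pow_succ]
          simp only [Real.sq_sqrt (Finset.sum_nonneg fun l _ => sq_nonneg _)]
          ring
      _ ≤ C * √(∑ j, (∫ τ, |T j τ| ∂νk) ^ 2) := by
          gcongr with j
          exact ih fun l => c (Fin.cons j l)
      _ ≤ C * ∫ τ, √(∑ j, T j τ ^ 2) ∂νk := by
          gcongr
          exact sqrt_sum_integral_abs_sq_le hT hnorm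
      _ ≤ ∫ τ, ∫ ω, |∑ j, T j τ * Y j ω| ∂ν ∂νk := by
          rw [← integral_const_mul]
          exact integral_mono (hnorm.const_mul _) hint.integral_prod_right fun τ => hlin _
      _ = ∫ ω, |∑ l, c l * ∏ s, Y (l s) (ω s)| ∂(Measure.pi fun _ : Fin (k + 1) => ν) := by
          rw [← hmp.integral_comp', ← integral_prod_symm _ hint]
          refine integral_congr_ae (ae_of_all _ fun z => ?_)
          simp only [hsum, T, Finset.sum_mul]
          congr! 3 with j _ l _
          rw [Fin.prod_univ_succ]
          simp [MeasurableEquiv.piFinSuccAbove]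
          ring

/-- Currying preserves product measures. -/
lemma measurePreserving_curry {Ω ι κ : Type*} [MeasurableSpace Ω] [Fintype ι] [Fintype κ]
    (μ : Measure Ω) [SigmaFinite μ] :
    MeasurePreserving (MeasurableEquiv.curry ι κ Ω) (Measure.pi fun _ => μ)
      (Measure.pi fun _ => Measure.pi fun _ => μ) := by
  refine MeasurePreserving.symm (MeasurableEquiv.curry ι κ Ω).symm
    ⟨(MeasurableEquiv.curry ι κ Ω).symm.measurable, (Measure.pi_eq fun s hs => ?_).symm⟩
  rw [MeasurableEquiv.map_apply]
  have : (MeasurableEquiv.curry ι κ Ω).symm ⁻¹' Set.univ.pi s =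
      Set.univ.pi fun a => Set.univ.pi fun b => s (a, b) := by
    ext f
    simp [MeasurableEquiv.curry, Set.mem_pi, Function.uncurry]
  rw [this]
  simp only [Measure.pi_pi, Fintype.prod_prod_type]

/-! ### Pauli strings -/

lemma trace_pauli_mul_pauli (p q : Fin 4) :
    (pauli p * pauli q).trace = if p = q then 2 else 0 := by
  fin_cases p <;> fin_cases q <;> norm_num [pauli, Matrix.trace, Matrix.mul_apply]

lemma trace_pauliStringOn_mul {ι : Type*} [Fintype ι] [DecidableEq ι] (P Q : ι → Fin 4) :
    (pauliStringOn P * pauliStringOn Q).trace =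
      if P = Q then (2 : ℂ) ^ Fintype.card ι else 0 := by
  have h : (pauliStringOn P * pauliStringOn Q).trace =
      ∏ i, (pauli (P i) * pauli (Q i)).trace := by
    simp only [Matrix.trace, Matrix.diag_apply, Matrix.mul_apply, pauliStringOn,
      ← Finset.prod_mul_distrib, Fintype.prod_sum]
  simp only [h, trace_pauli_mul_pauli, Finset.prod_ite_zero, Finset.mem_univ, forall_const,
    funext_iff, Finset.prod_const, Finset.card_univ]

lemma trace_pauliStringOn_mul_productStateOn {ι : Type*} [Fintype ι] [DecidableEq ι]
    (P : ι → Fin 4) (U : ι → Matrix (Fin 2) (Fin 2) ℂ) :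
    (pauliStringOn P * productStateOn U).trace = ∏ i, qubitExpect (pauli (P i)) (U i) := by
  have h (M V : Matrix (Fin 2) (Fin 2) ℂ) : qubitExpect M V =
      ∑ x, ∑ y, M x y * (haarVec V y * (starRingEnd ℂ) (haarVec V x)) := by
    simp [qubitExpect, haarVec, Matrix.mulVec, dotProduct, Matrix.mul_apply, Fin.sum_univ_two]
    ring
  simp only [Matrix.trace, Matrix.diag_apply, Matrix.mul_apply, pauliStringOn, productStateOn,
    ← Finset.prod_mul_distrib, h, Fintype.prod_sum]

/-- The squared Frobenius norm of a real combination of distinct Pauli strings. -/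
lemma trace_sum_pauliStringOn_sq {ι X : Type*} [Fintype ι] [DecidableEq ι] [Fintype X]
    {Q : X → ι → Fin 4} (hQ : Function.Injective Q) (a : X → ℝ) :
    ((∑ x, (a x : ℂ) • pauliStringOn (Q x)) * ∑ x, (a x : ℂ) • pauliStringOn (Q x)).trace =
      ((2 ^ Fintype.card ι * ∑ x, a x ^ 2 : ℝ) : ℂ) := by
  classical
  simp only [Matrix.sum_mul, Matrix.mul_sum, Matrix.trace_sum, Matrix.smul_mul, Matrix.mul_smul,
    Matrix.trace_smul, trace_pauliStringOn_mul, hQ.eq_iff, smul_eq_mul, mul_ite, mul_zero,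
    Finset.sum_ite_eq', Finset.mem_univ, if_true]
  push_cast
  rw [Finset.mul_sum]
  exact Finset.sum_congr rfl fun x _ => by ring

lemma qubitExpect_pauli_succ (a : Fin 3) (U : Matrix (Fin 2) (Fin 2) ℂ) :
    qubitExpect (pauli a.succ) U = blochCoord a U := by
  refine Complex.ext rfl ?_
  fin_cases a <;> simp [qubitExpect, pauli, Matrix.mul_apply, Fin.sum_univ_two] <;> ring

lemma qubitExpect_pauli_zero {U : Matrix (Fin 2) (Fin 2) ℂ}
    (hU : U ∈ unitary (Matrix (Fin 2) (Fin 2) ℂ)) : qubitExpect (pauli 0) U = 1 := by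
  have h := congrFun (congrFun (Unitary.mem_iff.1 hU).1 0) 0
  simpa [qubitExpect, pauli, Matrix.star_eq_conjTranspose] using h

/-- The Pauli string on `k × n` qubits acting on exactly one qubit of each of the `k` rows: in row
`s` it acts on qubit `(s, (l s).1)` as the nontrivial Pauli matrix with index `(l s).2`. -/
def rowString {n k : ℕ} (l : Fin k → Fin n × Fin 3) : Fin k × Fin n → Fin 4 :=
  fun si => if si.2 = (l si.1).1 then (l si.1).2.succ else 0

lemma rowString_injective {n k : ℕ} :
    Function.Injective (rowString : (Fin k → Fin n × Fin 3) → Fin k × Fin n → Fin 4) := by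
  intro l l' h
  funext s
  have h1 := congrFun h (s, (l s).1)
  simp only [rowString, if_true] at h1
  split_ifs at h1 with h2
  · exact Prod.ext h2 (Fin.succ_injective _ h1)
  · exact absurd h1 (Fin.succ_ne_zero _)

lemma trace_rowString_mul_productStateOn {n k : ℕ} (l : Fin k → Fin n × Fin 3)
    {U : Fin k × Fin n → Matrix (Fin 2) (Fin 2) ℂ}
    (hU : ∀ si, U si ∈ unitary (Matrix (Fin 2) (Fin 2) ℂ)) :
    (pauliStringOn (rowString l) * productStateOn U).trace =
      ((∏ s, blochCoord (l s).2 (U (s, (l s).1)) : ℝ) : ℂ) := by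
  rw [trace_pauliStringOn_mul_productStateOn, Fintype.prod_prod_type, Complex.ofReal_prod]
  refine Finset.prod_congr rfl fun s _ => ?_
  rw [Finset.prod_eq_single (l s).1, rowString, if_pos rfl, qubitExpect_pauli_succ]
  · intro i _ hi
    rw [rowString, if_neg hi, qubitExpect_pauli_zero (hU _)]
  · simp

/-- The rows of the polarized Pauli string `pol_π(P)`. -/
def polRow {n k : ℕ} (P : Fin n → Fin 4) (hP : (psupp P).card = k) (π : Equiv.Perm (Fin k))
    (s : Fin k) : Fin n × Fin 3 :=
  let i := (psupp P).orderIsoOfFin hP (π.symm s)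
  (i, (P i).pred (Finset.mem_filter.1 i.2).2)

lemma polString_eq_rowString {n k : ℕ} (P : Fin n → Fin 4) (hP : (psupp P).card = k)
    (π : Equiv.Perm (Fin k)) : polString P hP π = rowString (polRow P hP π) := by
  funext ⟨s, i⟩
  simp only [polString, rowString, polRow, Fin.succ_pred]
  by_cases h : i ∈ psupp P
  · have hiff : s = π (((psupp P).orderIsoOfFin hP).symm ⟨i, h⟩) ↔
        i = ((psupp P).orderIsoOfFin hP (π.symm s) : Fin n) := by
      rw [← Equiv.symm_apply_eq, OrderIso.eq_symm_apply, Subtype.ext_iff, eq_comm]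
    rw [dif_pos h]
    by_cases hs : i = ((psupp P).orderIsoOfFin hP (π.symm s) : Fin n)
    · rw [if_pos (hiff.2 hs), if_pos hs, ← hs]
    · rw [if_neg (mt hiff.1 hs), if_neg hs]
  · rw [dif_neg h, if_neg]
    rintro rfl
    exact h (Subtype.coe_prop _)

lemma polRow_injective {n k : ℕ} : Function.Injective
    fun x : {P : Fin n → Fin 4 // (psupp P).card = k} × Equiv.Perm (Fin k) =>
      polRow x.1.1 x.1.2 x.2 := by
  have key (P : Fin n → Fin 4) (hP : (psupp P).card = k) (π : Equiv.Perm (Fin k)) (i : Fin n)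
      (a : Fin 3) : (∃ s, polRow P hP π s = (i, a)) ↔ P i = a.succ := by
    constructor
    · rintro ⟨s, hs⟩
      obtain ⟨rfl, rfl⟩ := Prod.ext_iff.1 hs
      simp [polRow]
    · intro h
      have hi : i ∈ psupp P :=
        Finset.mem_filter.2 ⟨Finset.mem_univ i, h ▸ Fin.succ_ne_zero a⟩
      refine ⟨π (((psupp P).orderIsoOfFin hP).symm ⟨i, hi⟩), ?_⟩
      simp [polRow, h]
  rintro ⟨⟨P, hP⟩, π⟩ ⟨⟨P', hP'⟩, π'⟩ h
  simp only at h
  have hPP : P = P' := by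
    have hiff (i : Fin n) (a : Fin 3) : P i = a.succ ↔ P' i = a.succ := by
      rw [← key P hP π, ← key P' hP' π', h]
    funext i
    rcases Fin.eq_zero_or_eq_succ (P i) with h0 | ⟨a, ha⟩
    · rcases Fin.eq_zero_or_eq_succ (P' i) with h0' | ⟨a, ha⟩
      · rw [h0, h0']
      · rw [ha, (hiff i a).2 ha]
    · rw [ha, (hiff i a).1 ha]
  subst hPP
  have hπ : π.symm = π'.symm := by
    ext1 s
    have := congrArg Prod.fst (congrFun h s)
    simpa [polRow, -Finset.coe_orderIsoOfFin_apply, Subtype.coe_inj] using this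
  rw [Equiv.symm_bijective.injective hπ]

/-- Khintchine's inequality for combinations of products of independent Haar-random Bloch
coordinates, one from each row. -/
lemma row_khintchine {μ : Measure (Matrix (Fin 2) (Fin 2) ℂ)} [IsProbabilityMeasure μ]
    (hunit : ∀ᵐ U ∂μ, U ∈ unitary (Matrix (Fin 2) (Fin 2) ℂ))
    (hinv : ∀ V ∈ unitary (Matrix (Fin 2) (Fin 2) ℂ), Measure.map (fun U => V * U) μ = μ)
    {n k : ℕ} {X : Type*} [Fintype X] {l : X → Fin k → Fin n × Fin 3}
    (hl : Function.Injective l) (a : X → ℝ) :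
    (√6)⁻¹ ^ k * √(∑ x, a x ^ 2) ≤
      ∫ U, |∑ x, a x * ∏ s, blochCoord (l x s).2 (U (s, (l x s).1))|
        ∂(Measure.pi fun _ : Fin k × Fin n => μ) := by
  have hint (j : Fin n × Fin 3) :
      Integrable (fun V : Fin n → Matrix (Fin 2) (Fin 2) ℂ => blochCoord j.2 (V j.1))
        (Measure.pi fun _ => μ) := by
    refine Integrable.of_bound
      ((measurable_blochCoord j.2).comp (measurable_pi_apply j.1)).aestronglyMeasurable 1 ?_
    filter_upwards [Measure.tendsto_eval_ae_ae.eventually hunit] with V hV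
    exact abs_blochCoord_le hV j.2
  have htensor := khintchine_tensor (Measure.pi fun _ : Fin n => μ) _ hint (by positivity)
    (bloch_khintchine hunit hinv) k (Function.extend l a 0)
  rw [← (measurePreserving_curry μ).integral_comp'] at htensor
  have hsum (f : ℝ → (Fin k → Fin n × Fin 3) → ℝ) (hf : ∀ m, f 0 m = 0) :
      ∑ m, f (Function.extend l a 0 m) m = ∑ x, f (a x) (l x) := by
    refine (Fintype.sum_of_injective l hl _ _ (fun m hm => ?_) fun x => ?_).symm
    · rw [Function.extend_apply' _ _ _ hm]
      exact hf m
    · rw [hl.extend_apply]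
  rw [hsum (fun t _ => t ^ 2) (by simp)] at htensor
  refine htensor.trans_eq (integral_congr_ae (ae_of_all _ fun U => ?_))
  exact congrArg abs (hsum (fun t m => t * ∏ s, blochCoord (m s).2 (U (s, (m s).1))) (by simp))

/-- Khintchine inequality for polarized observables: for a homogeneous `k`-local
`n`-qubit observable `O' = ∑_{|P|=k} α_P P` and its polarization
`O = pol(O') = ∑_P α_P (1/k!) ∑_{π ∈ S_k} pol_π(P)` on `nk` qubits, the (normalized)
Frobenius norms satisfy `Tr(O'²)/2ⁿ = k! · Tr(O²)/2^{nk}`, and for `|ψ⟩` a tensor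
product of `nk` independent Haar-random single-qubit pure states,
`E|⟨ψ|O|ψ⟩| ≥ (1/√6)^k √(Tr(O²)/2^{nk})`. -/
theorem khintchine_polarized (n k : ℕ) (α : (Fin n → Fin 4) → ℝ)
    (hhom : ∀ P, α P ≠ 0 → (psupp P).card = k)
    (O' : Matrix (Fin n → Fin 2) (Fin n → Fin 2) ℂ)
    (hO' : O' = ∑ P : Fin n → Fin 4, (α P : ℂ) • pauliStringOn P)
    (O : Matrix (Fin k × Fin n → Fin 2) (Fin k × Fin n → Fin 2) ℂ)
    (hO : O = ∑ P : Fin n → Fin 4, (α P : ℂ) •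
      ((k.factorial : ℂ)⁻¹ • ∑ π : Equiv.Perm (Fin k),
        if h : (psupp P).card = k then pauliStringOn (polString P h π) else 0))
    (μ : Measure (Matrix (Fin 2) (Fin 2) ℂ)) [IsProbabilityMeasure μ]
    (hunit : ∀ᵐ U ∂μ, U ∈ unitary (Matrix (Fin 2) (Fin 2) ℂ))
    (hinv : ∀ V ∈ unitary (Matrix (Fin 2) (Fin 2) ℂ),
      Measure.map (fun U => V * U) μ = μ) :
    ((O' * O').trace / 2 ^ n : ℂ) = (k.factorial : ℂ) * ((O * O).trace / 2 ^ (n * k)) ∧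
    (Real.sqrt 6)⁻¹ ^ k * Real.sqrt (((O * O).trace).re / 2 ^ (n * k)) ≤
      ∫ U, ‖(O * productStateOn U).trace‖
        ∂(Measure.pi fun _ : Fin k × Fin n => μ) := by
  let X := {P : Fin n → Fin 4 // (psupp P).card = k} × Equiv.Perm (Fin k)
  let a : X → ℝ := fun x => α x.1 * (k.factorial : ℝ)⁻¹
  let l : X → Fin k → Fin n × Fin 3 := fun x => polRow x.1.1 x.1.2 x.2
  have hl : Function.Injective l := polRow_injective
  have hsub {M : Type} [AddCommMonoid M] (f : (Fin n → Fin 4) → M)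
      (hf : ∀ P, α P = 0 → f P = 0) :
      ∑ P, f P = ∑ P : {P : Fin n → Fin 4 // (psupp P).card = k}, f P :=
    (Fintype.sum_of_injective _ Subtype.val_injective _ _
      (fun P hP => hf P (by_contra fun h => hP ⟨⟨P, hhom P h⟩, rfl⟩)) fun _ => rfl).symm
  have hO'sum : O' = ∑ P : {P : Fin n → Fin 4 // (psupp P).card = k},
      (α P : ℂ) • pauliStringOn P.1 := by
    rw [hO', hsub _ fun P hP => by simp [hP]]
  have hOsum : O = ∑ x, (a x : ℂ) • pauliStringOn (rowString (l x)) := by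
    rw [hO, hsub _ fun P hP => by simp [hP], Fintype.sum_prod_type]
    refine Finset.sum_congr rfl fun P _ => ?_
    rw [smul_smul, Finset.smul_sum]
    refine Finset.sum_congr rfl fun π _ => ?_
    rw [dif_pos P.2, polString_eq_rowString]
    simp [a, l]
  have htr' : (O' * O').trace = ((2 ^ n * ∑ P : {P : Fin n → Fin 4 // (psupp P).card = k},
      α P ^ 2 : ℝ) : ℂ) := by
    rw [hO'sum, trace_sum_pauliStringOn_sq Subtype.val_injective fun P => α P.1, Fintype.card_fin]
  have htr : (O * O).trace = ((2 ^ (n * k) * ∑ x, a x ^ 2 : ℝ) : ℂ) := by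
    rw [hOsum, trace_sum_pauliStringOn_sq (Q := fun x => rowString (l x))
      (rowString_injective.comp hl), Fintype.card_prod, Fintype.card_fin,
      Fintype.card_fin, mul_comm n k]
  have ha : ∑ P : {P : Fin n → Fin 4 // (psupp P).card = k}, α P ^ 2 =
      k.factorial * ∑ x, a x ^ 2 := by
    have hk : (k.factorial : ℝ) ≠ 0 := by positivity
    rw [Fintype.sum_prod_type, Finset.mul_sum]
    refine Finset.sum_congr rfl fun P _ => ?_
    simp only [a, Finset.sum_const, Finset.card_univ, Fintype.card_perm, Fintype.card_fin,
      nsmul_eq_mul]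
    field_simp
  refine ⟨?_, ?_⟩
  · rw [htr', htr, ha]
    push_cast
    field_simp
  · rw [htr, Complex.ofReal_re, mul_div_cancel_left₀ _ (by positivity)]
    refine (row_khintchine hunit hinv hl a).trans_eq (integral_congr_ae ?_)
    have hU : ∀ᵐ U ∂(Measure.pi fun _ : Fin k × Fin n => μ),
        ∀ si, U si ∈ unitary (Matrix (Fin 2) (Fin 2) ℂ) :=
      ae_all_iff.2 fun _ => Measure.tendsto_eval_ae_ae.eventually hunit
    filter_upwards [hU] with U hU
    rw [hOsum]
    simp only [Matrix.sum_mul, Matrix.trace_sum, Matrix.smul_mul, Matrix.trace_smul,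
      trace_rowString_mul_productStateOn _ hU, smul_eq_mul, ← Complex.ofReal_mul,
      ← Complex.ofReal_sum, Complex.norm_real, Real.norm_eq_abs]
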